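/- Let G be a finite abelian group, and let ρ, σ be representations of G on finite-dimensional complex vector spaces V and W. Suppose there is exactly one character χ₀ : G → ℂˣ such that both V_{χ₀} ≠ 0 and W_{χ₀⁻¹} ≠ 0, that dim V_{χ₀} = 1, and that η spans V_{χ₀}. Then the subspace of G-invariants of the diagonal representation on V ⊗ W equals {η ⊗ w : w ∈ W_{χ₀⁻¹}}; in particular every G-invariant element of V ⊗ W is of the form η ⊗ w with w ∈ W_{χ₀⁻¹}, and the space of invariants has dimension dim W_{χ₀⁻¹}. -/

import Mathlib

open scoped TensorProduct

/-- The χ-isotypic component of a representation: the subspace of vectors on which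
every `g : G` acts as multiplication by the scalar `χ g`. -/
def isotypic {G : Type*} [CommGroup G] {V : Type*} [AddCommGroup V] [Module ℂ V]
    (ρ : Representation ℂ G V) (χ : G →* ℂˣ) : Submodule ℂ V where
  carrier := {v | ∀ g : G, ρ g v = (χ g : ℂ) • v}
  add_mem' := by
    intro a b ha hb g
    simp [map_add, ha g, hb g, smul_add]
  zero_mem' := by
    intro g; simp
  smul_mem' := by
    intro c v hv g
    simp only [map_smul, hv g]
    rw [smul_comm]

namespace isotypic

variable {G : Type*} [CommGroup G] {V : Type*} [AddCommGroup V] [Module ℂ V]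
  {W : Type*} [AddCommGroup W] [Module ℂ W]

theorem mem_iff {ρ : Representation ℂ G V} {χ : G →* ℂˣ} {v : V} :
    v ∈ isotypic ρ χ ↔ ∀ g : G, ρ g v = (χ g : ℂ) • v :=
  Iff.rfl

/-- A simultaneous eigenvector of a group representation is acted on through a character. -/
theorem exists_mem_of_forall_apply_eq_smul (ρ : Representation ℂ G V) {v : V} (hv : v ≠ 0)
    (c : G → ℂ) (hc : ∀ g, ρ g v = c g • v) : ∃ χ : G →* ℂˣ, v ∈ isotypic ρ χ := by
  have h_one : c 1 = 1 := smul_left_injective ℂ hv (by simp [← hc])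
  have h_mul (g h : G) : c (g * h) = c g * c h := by
    refine smul_left_injective ℂ hv ?_
    change c (g * h) • v = (c g * c h) • v
    rw [← hc, map_mul, Module.End.mul_apply, hc h, map_smul, hc g, smul_smul, mul_comm]
  exact ⟨MonoidHom.toHomUnits ⟨⟨c, h_one⟩, h_mul⟩, hc⟩

/-- Every operator of a complex representation of a finite group is semisimple. -/
theorem isSemisimple_apply [Finite G] (ρ : Representation ℂ G V) (g : G) :
    Module.End.IsSemisimple (ρ g) := by
  have hsep : (Polynomial.X ^ Nat.card G - 1 : Polynomial ℂ).Separable :=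
    Polynomial.X_pow_sub_one_separable_iff.mpr (Nat.cast_ne_zero.mpr Nat.card_pos.ne')
  refine Module.End.isSemisimple_of_squarefree_aeval_eq_zero hsep.squarefree ?_
  rw [map_sub, map_pow, Polynomial.aeval_X, map_one, ← map_pow, pow_card_eq_one', map_one,
    sub_self]

/-- A finite-dimensional complex representation of a finite abelian group is the sum of its
isotypic components. -/
theorem iSup_eq_top [Finite G] [FiniteDimensional ℂ V] (ρ : Representation ℂ G V) :
    ⨆ χ : G →* ℂˣ, isotypic ρ χ = ⊤ := by
  rw [eq_top_iff,
    ← Module.End.iSup_iInf_maxGenEigenspace_eq_top_of_iSup_maxGenEigenspace_eq_top_of_commute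
      (fun g ↦ ρ g) (fun g h _ ↦ (Commute.all g h).map ρ)
      fun g ↦ Module.End.iSup_maxGenEigenspace_eq_top _]
  refine iSup_le fun c v hv ↦ ?_
  replace hv (g : G) : ρ g v = c g • v := by
    rw [← Module.End.mem_eigenspace_iff,
      ← (isSemisimple_apply ρ g).isFinitelySemisimple.maxGenEigenspace_eq_eigenspace]
    exact (Submodule.mem_iInf _).mp hv g
  obtain rfl | hv₀ := eq_or_ne v 0
  · exact zero_mem _
  · obtain ⟨χ, hχ⟩ := exists_mem_of_forall_apply_eq_smul ρ hv₀ c hv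
    exact Submodule.mem_iSup_of_mem χ hχ

theorem tmul_mem {ρ : Representation ℂ G V} {σ : Representation ℂ G W} {χ ψ : G →* ℂˣ}
    {v : V} {w : W} (hv : v ∈ isotypic ρ χ) (hw : w ∈ isotypic σ ψ) :
    v ⊗ₜ[ℂ] w ∈ isotypic (ρ.tprod σ) (χ * ψ) := fun g ↦ by
  rw [Representation.tprod_apply, TensorProduct.map_tmul, hv g, hw g,
    TensorProduct.smul_tmul_smul, MonoidHom.mul_apply, Units.val_mul]

theorem one_eq_invariants (ρ : Representation ℂ G V) : isotypic ρ 1 = ρ.invariants := by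
  ext v
  simp [mem_iff, Representation.mem_invariants]

theorem averageMap_eq_zero [Fintype G] [Invertible (Fintype.card G : ℂ)]
    {ρ : Representation ℂ G V} {χ : G →* ℂˣ} (hχ : χ ≠ 1) {v : V} (hv : v ∈ isotypic ρ χ) :
    ρ.averageMap v = 0 := by
  obtain ⟨g, hg⟩ := DFunLike.ne_iff.mp hχ
  have h : ρ.averageMap (ρ g v) = ρ.averageMap v := by
    rw [Representation.averageMap, ← Representation.asAlgebraHom_single_one ρ g,
      ← Module.End.mul_apply, ← map_mul, GroupAlgebra.mul_average_right]
  rw [mem_iff.mp hv g, map_smul] at h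
  by_contra h₀
  refine hg (Units.ext (smul_left_injective ℂ h₀ ?_))
  simpa using h

end isotypic

theorem TensorProduct.mk_injective_of_ne_zero {K V W : Type*} [Field K] [AddCommGroup V]
    [Module K V] [AddCommGroup W] [Module K W] {v : V} (hv : v ≠ 0) :
    Function.Injective (TensorProduct.mk K V W v) := by
  obtain ⟨f, hf⟩ := Module.Projective.exists_dual_eq_one K hv
  refine Function.LeftInverse.injective
    (g := TensorProduct.lid K W ∘ TensorProduct.map f LinearMap.id) fun w ↦ ?_
  simp [hf]

/-- If `χ₀` is the unique character with `V_{χ₀} ≠ 0` and `W_{χ₀⁻¹} ≠ 0`, if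
`dim V_{χ₀} = 1` and `η` spans `V_{χ₀}`, then the `G`-invariants of the diagonal
representation on `V ⊗ W` are exactly the tensors `η ⊗ w` with `w ∈ W_{χ₀⁻¹}`, and the
space of invariants has dimension `dim W_{χ₀⁻¹}`. -/
theorem invariants_tprod_of_unique_character
    {G : Type*} [CommGroup G] [Finite G]
    {V : Type*} [AddCommGroup V] [Module ℂ V] [FiniteDimensional ℂ V]
    {W : Type*} [AddCommGroup W] [Module ℂ W] [FiniteDimensional ℂ W]
    (ρ : Representation ℂ G V) (σ : Representation ℂ G W)
    (χ₀ : G →* ℂˣ) (η : V)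
    (h₀ : isotypic ρ χ₀ ≠ ⊥ ∧ isotypic σ χ₀⁻¹ ≠ ⊥)
    (huniq : ∀ χ : G →* ℂˣ, isotypic ρ χ ≠ ⊥ → isotypic σ χ⁻¹ ≠ ⊥ → χ = χ₀)
    (hdim : Module.finrank ℂ ↥(isotypic ρ χ₀) = 1)
    (hη : Submodule.span ℂ {η} = isotypic ρ χ₀) :
    ((↑(ρ.tprod σ).invariants : Set (V ⊗[ℂ] W)) =
        {x : V ⊗[ℂ] W | ∃ w ∈ isotypic σ χ₀⁻¹, x = η ⊗ₜ[ℂ] w}) ∧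
      Module.finrank ℂ ↥(ρ.tprod σ).invariants =
        Module.finrank ℂ ↥(isotypic σ χ₀⁻¹) := by
  classical
  have := Fintype.ofFinite G
  have : Invertible (Fintype.card G : ℂ) :=
    invertibleOfNonzero (Nat.cast_ne_zero.mpr Fintype.card_ne_zero)
  have hη_mem : η ∈ isotypic ρ χ₀ := hη ▸ Submodule.mem_span_singleton_self η
  have hη_ne : η ≠ 0 := by
    rintro rfl
    exact h₀.1 (by simp [← hη])
  let S := (isotypic σ χ₀⁻¹).map (TensorProduct.mk ℂ V W η)
  have hS : S ≤ (ρ.tprod σ).invariants := by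
    rintro _ ⟨w, hw, rfl⟩
    rw [← isotypic.one_eq_invariants, ← mul_inv_cancel χ₀]
    exact isotypic.tmul_mem hη_mem hw
  have h_pure {χ ψ : G →* ℂˣ} {v : V} {w : W} (hv : v ∈ isotypic ρ χ) (hw : w ∈ isotypic σ ψ) :
      (ρ.tprod σ).averageMap (v ⊗ₜ[ℂ] w) ∈ S := by
    have hvw := isotypic.tmul_mem hv hw
    by_cases hχψ : χ * ψ = 1
    · obtain rfl : ψ = χ⁻¹ :=
        MonoidHom.ext fun g ↦ eq_inv_of_mul_eq_one_right (DFunLike.congr_fun hχψ g)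
      obtain rfl | hv₀ := eq_or_ne v 0
      · simp
      obtain rfl | hw₀ := eq_or_ne w 0
      · simp
      obtain rfl := huniq χ ((Submodule.ne_bot_iff _).mpr ⟨v, hv, hv₀⟩)
        ((Submodule.ne_bot_iff _).mpr ⟨w, hw, hw₀⟩)
      rw [hχψ, isotypic.one_eq_invariants] at hvw
      rw [Representation.averageMap_id _ _ hvw]
      obtain ⟨c, rfl⟩ := Submodule.mem_span_singleton.mp (hη ▸ hv)
      exact ⟨c • w, Submodule.smul_mem _ c hw, by simp [TensorProduct.smul_tmul]⟩
    · rw [isotypic.averageMap_eq_zero hχψ hvw]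
      exact zero_mem S
  have h_average (x : V ⊗[ℂ] W) : (ρ.tprod σ).averageMap x ∈ S := by
    induction x with
    | zero => rw [map_zero]; exact zero_mem S
    | add x y hx hy => rw [map_add]; exact add_mem hx hy
    | tmul v w =>
      have hv : v ∈ ⨆ χ : G →* ℂˣ, isotypic ρ χ := isotypic.iSup_eq_top ρ ▸ Submodule.mem_top
      have hw : w ∈ ⨆ χ : G →* ℂˣ, isotypic σ χ := isotypic.iSup_eq_top σ ▸ Submodule.mem_top
      induction hv using Submodule.iSup_induction' with
      | zero => rw [TensorProduct.zero_tmul, map_zero]; exact zero_mem S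
      | add v v' _ _ h h' => rw [TensorProduct.add_tmul, map_add]; exact add_mem h h'
      | mem χ v hv =>
        induction hw using Submodule.iSup_induction' with
        | zero => rw [TensorProduct.tmul_zero, map_zero]; exact zero_mem S
        | add w w' _ _ h h' => rw [TensorProduct.tmul_add, map_add]; exact add_mem h h'
        | mem ψ w hw => exact h_pure hv hw
  have h_eq : (ρ.tprod σ).invariants = S :=
    le_antisymm (fun x hx ↦ Representation.averageMap_id _ x hx ▸ h_average x) hS
  rw [h_eq]
  refine ⟨?_, (Submodule.equivMapOfInjective _
    (TensorProduct.mk_injective_of_ne_zero hη_ne) _).finrank_eq.symm⟩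
  ext x
  simp [S, eq_comm]
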